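/- arXiv:2209.15388 — 4 statements merged into one kernel-verified Lean document; each statement's English description precedes it below -/
import Mathlib

section
/- Let p be a prime with p ≡ 3 (mod 4), let m ≥ 1, and let β ∈ ℤ[i] be a Gaussian integer with β ≠ 1 such that p divides β − 1. Let j be the multiplicity of p in β − 1 (so j ≥ 1) and set t = min(j, m). Let N̄ and D̄ denote the additive endomorphisms of the quotient ring ℤ[i]/(p^m) given by multiplication by N = Σ_{k=0}^{p^m − 1} β^k and by D = β − 1, respectively. Then the image of D̄ is contained in the kernel of N̄, and the quotient group ker(N̄)/im(D̄) is isomorphic as an abelian group to (ℤ/p^t ℤ) × (ℤ/p^t ℤ). (This quotient computes the group cohomology H¹(ℤ/p^m ℤ, ℤ[i]/p^m) for the action of ℤ/p^m ℤ on ℤ[i]/p^m in which a generator acts as multiplication by β.) -/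
open GaussianInt

theorem geom_sum_range_mul {R : Type*} [CommSemiring R] (x : R) (a b : ℕ) :
    ∑ k ∈ Finset.range (a * b), x ^ k =
      (∑ k ∈ Finset.range a, x ^ k) * ∑ l ∈ Finset.range b, (x ^ a) ^ l := by
  induction b with
  | zero => simp
  | succ b ih =>
    rw [mul_add_one, Finset.sum_range_add, ih, Finset.sum_range_succ, mul_add, ← pow_mul]
    simp only [pow_add, Finset.sum_mul, mul_comm (x ^ (a * b))]

theorem pow_dvd_geom_sum_of_dvd_sub_one {R : Type*} [CommRing R] {p : ℕ} {x : R}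
    (h : (p : R) ∣ x - 1) (m : ℕ) :
    (p : R) ^ m ∣ ∑ k ∈ Finset.range (p ^ m), x ^ k := by
  induction m with
  | zero => simp
  | succ m ih =>
    have hp : (p : R) ∣ ∑ l ∈ Finset.range p, (x ^ p ^ m) ^ l := by
      have hsum : ∑ l ∈ Finset.range p, (x ^ p ^ m) ^ l =
          ∑ l ∈ Finset.range p, ((x ^ p ^ m) ^ l - 1) + p := by simp
      rw [hsum]
      refine dvd_add (Finset.dvd_sum fun l _ => ?_) dvd_rfl
      rw [← pow_mul]
      exact h.trans (sub_one_dvd_pow_sub_one x _)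
    rw [pow_succ, pow_succ, geom_sum_range_mul]
    exact mul_dvd_mul ih hp

/-- Reduction modulo `n` of the real and imaginary parts of a Gaussian integer. -/
def GaussianInt.reImMod (n : ℕ) : GaussianInt →+ ZMod n × ZMod n where
  toFun z := (z.re, z.im)
  map_zero' := by simp
  map_add' z w := by simp

theorem GaussianInt.reImMod_surjective (n : ℕ) : Function.Surjective (reImMod n) := by
  rintro ⟨a, b⟩
  obtain ⟨x, rfl⟩ := ZMod.intCast_surjective a
  obtain ⟨y, rfl⟩ := ZMod.intCast_surjective b
  exact ⟨⟨x, y⟩, rfl⟩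

theorem GaussianInt.reImMod_eq_zero_iff (n : ℕ) (z : GaussianInt) :
    reImMod n z = 0 ↔ (n : GaussianInt) ∣ z := by
  have h := Zsqrtd.intCast_dvd (d := -1) (n : ℤ) z
  rw [Int.cast_natCast] at h
  rw [h, ← CharP.intCast_eq_zero_iff (ZMod n), ← CharP.intCast_eq_zero_iff (ZMod n)]
  exact Prod.ext_iff

/-- For a prime `π` of a principal ideal domain dividing `x` exactly `j` times, the ideal
`(x, π ^ m)` is generated by `π ^ min j m`. -/
theorem exists_dvd_sub_mul_iff_pow_min_dvd {R : Type*} [CommRing R] [IsDomain R]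
    [IsPrincipalIdealRing R] {π x : R} (hπ : Prime π) {j : ℕ} (m : ℕ)
    (hdvd : π ^ j ∣ x) (hndvd : ¬ π ^ (j + 1) ∣ x) (z : R) :
    (∃ w, π ^ m ∣ z - x * w) ↔ π ^ min j m ∣ z := by
  constructor
  · rintro ⟨w, hw⟩
    have h := dvd_add ((pow_dvd_pow π (min_le_right j m)).trans hw)
      (((pow_dvd_pow π (min_le_left j m)).trans hdvd).mul_right w)
    rwa [sub_add_cancel] at h
  · intro hz
    rcases le_total j m with hjm | hmj
    · rw [min_eq_left hjm] at hz
      obtain ⟨u, rfl⟩ := hdvd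
      obtain ⟨y, rfl⟩ := hz
      have hu : ¬ π ∣ u := fun h => hndvd (by rw [pow_succ]; exact mul_dvd_mul_left _ h)
      obtain ⟨a, b, hab⟩ := (hπ.irreducible.coprime_iff_not_dvd.2 hu).pow_left (m := m)
      exact ⟨b * y, π ^ j * a * y, by linear_combination (-(π ^ j * y)) * hab⟩
    · rw [min_eq_right hmj] at hz
      exact ⟨0, by simpa using hz⟩

/-- For a prime `p ≡ 3 mod 4`, `m ≥ 1`, and `β ∈ ℤ[i]` with `β ≠ 1` such that
`p` divides `β - 1` with multiplicity exactly `j ≥ 1`, setting `t = min j m`,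
`N = ∑_{k<p^m} β^k` and `D = β - 1`, the image of multiplication by the class of `D` on
`ℤ[i]/(p^m)` is contained in the kernel of multiplication by the class of `N`, and the
quotient `ker(N̄)/im(D̄)` is isomorphic as an abelian group to `(ℤ/p^t) × (ℤ/p^t)`. -/
theorem stmt_0 (p : ℕ) (hp : p.Prime) (hp3 : p % 4 = 3) (m : ℕ) (hm : 1 ≤ m)
    (β : GaussianInt) (hβ : β ≠ 1) (j : ℕ) (hj : 1 ≤ j)
    (hdvd : (p : GaussianInt) ^ j ∣ β - 1) (hndvd : ¬ (p : GaussianInt) ^ (j + 1) ∣ β - 1)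
    (t : ℕ) (ht : t = min j m)
    (Nbar Dbar : (GaussianInt ⧸ Ideal.span {(p : GaussianInt) ^ m}) →+
      (GaussianInt ⧸ Ideal.span {(p : GaussianInt) ^ m}))
    (hN : Nbar = AddMonoidHom.mulLeft
      (Ideal.Quotient.mk (Ideal.span {(p : GaussianInt) ^ m})
        (∑ k ∈ Finset.range (p ^ m), β ^ k)))
    (hD : Dbar = AddMonoidHom.mulLeft
      (Ideal.Quotient.mk (Ideal.span {(p : GaussianInt) ^ m}) (β - 1))) :
    Dbar.range ≤ Nbar.ker ∧
      Nonempty ((Nbar.ker ⧸ Dbar.range.addSubgroupOf Nbar.ker) ≃+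
        (ZMod (p ^ t) × ZMod (p ^ t))) := by
  have hpp : Prime (p : GaussianInt) :=
    haveI := Fact.mk hp
    prime_of_nat_prime_of_mod_four_eq_three p hp3
  have hpD : (p : GaussianInt) ∣ β - 1 := (dvd_pow_self _ (by lia)).trans hdvd
  have hker : Nbar.ker = ⊤ := by
    have h0 : Ideal.Quotient.mk (Ideal.span {(p : GaussianInt) ^ m})
        (∑ k ∈ Finset.range (p ^ m), β ^ k) = 0 :=
      Ideal.Quotient.eq_zero_iff_dvd _ _ |>.2 (pow_dvd_geom_sum_of_dvd_sub_one hpD m)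
    ext z
    simp [hN, h0, AddMonoidHom.mem_ker]
  refine ⟨hker ▸ le_top, ?_⟩
  have hle : (Ideal.span {(p : GaussianInt) ^ m}).toAddSubgroup ≤ (reImMod (p ^ t)).ker := by
    intro z hz
    have hz' : (p : GaussianInt) ^ m ∣ z := Ideal.mem_span_singleton.1 hz
    rw [AddMonoidHom.mem_ker, reImMod_eq_zero_iff, Nat.cast_pow]
    exact (pow_dvd_pow _ (ht ▸ min_le_right j m)).trans hz'
  let φ : (GaussianInt ⧸ Ideal.span {(p : GaussianInt) ^ m}) →+ ZMod (p ^ t) × ZMod (p ^ t) :=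
    QuotientAddGroup.lift _ (reImMod (p ^ t)) hle
  have hφ (z : GaussianInt) : φ (Ideal.Quotient.mk _ z) = reImMod (p ^ t) z := rfl
  have hrange : Dbar.range = φ.ker := by
    ext z
    obtain ⟨z, rfl⟩ := Ideal.Quotient.mk_surjective z
    rw [AddMonoidHom.mem_ker, hφ, reImMod_eq_zero_iff, Nat.cast_pow, ht,
      ← exists_dvd_sub_mul_iff_pow_min_dvd hpp m hdvd hndvd, AddMonoidHom.mem_range,
      Ideal.Quotient.mk_surjective.exists]
    refine exists_congr fun w => ?_
    rw [hD, AddMonoidHom.coe_mulLeft, ← map_mul, eq_comm, Ideal.Quotient.mk_eq_mk_iff_sub_mem,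
      Ideal.mem_span_singleton]
  have hsurj : Function.Surjective (φ.comp Nbar.ker.subtype) := by
    intro y
    obtain ⟨z, rfl⟩ := reImMod_surjective (p ^ t) y
    exact ⟨⟨Ideal.Quotient.mk _ z, hker ▸ AddSubgroup.mem_top _⟩, rfl⟩
  have hker' : Dbar.range.addSubgroupOf Nbar.ker = (φ.comp Nbar.ker.subtype).ker := by
    rw [hrange]
    rfl
  exact ⟨(QuotientAddGroup.quotientAddEquivOfEq hker').trans
    (QuotientAddGroup.quotientKerEquivOfSurjective _ hsurj)⟩
end

section
/- Let n ≥ 1 and let F be the finite field with 4^n elements (e.g. GaloisField 2 (2n)). Let W be the Weierstrass curve over F with coefficients a₁ = 0, a₂ = 1, a₃ = 1, a₄ = 1, a₆ = 1, i.e. the elliptic curve y² + y = x³ + x² + x + 1 base-changed from 𝔽₂. Then the number of F-rational points of W (including the point at infinity) equals ((−2)^n − 1)², i.e. (Nat.card of the point group of W over F : ℤ) = ((−2)^n − 1)². -/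
open Classical in
/-- The quadratic character attached to the Artin-Schreier map `y ↦ y² + y`: it is `1` on the
image of this map and `-1` elsewhere. -/
noncomputable def artinSchreierChar {F : Type*} [Field F] (c : F) : ℤ :=
  if ∃ y : F, y ^ 2 + y = c then 1 else -1

section ArtinSchreier

variable {F : Type*} [Field F]

theorem artinSchreierChar_sq_add_self (u : F) : artinSchreierChar (u ^ 2 + u) = 1 :=
  if_pos ⟨u, rfl⟩

theorem artinSchreierChar_zero : artinSchreierChar (0 : F) = 1 := by
  simpa using artinSchreierChar_sq_add_self (0 : F)

theorem artinSchreierChar_eq_one_or (c : F) :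
    artinSchreierChar c = 1 ∨ artinSchreierChar c = -1 := by
  unfold artinSchreierChar
  split_ifs <;> simp

variable [CharP F 2]

theorem sq_add_self_eq_iff (y z : F) : y ^ 2 + y = z ^ 2 + z ↔ y = z ∨ y = z + 1 := by
  have h2 : (2 : F) = 0 := CharTwo.two_eq_zero
  constructor
  · intro h
    have : (y - z) * (y - (z + 1)) = 0 := by
      linear_combination h + (z ^ 2 + z - y - y * z) * h2
    rcases mul_eq_zero.mp this with h | h
    · exact Or.inl (sub_eq_zero.mp h)
    · exact Or.inr (sub_eq_zero.mp h)
  · rintro (rfl | rfl)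
    · rfl
    · linear_combination (z + 1) * h2

/-- The additive map `y ↦ y² + y` in characteristic two. -/
def artinSchreierHom (F : Type*) [Field F] [CharP F 2] : F →+ F where
  toFun y := y ^ 2 + y
  map_zero' := by simp
  map_add' x y := by rw [CharTwo.add_sq]; ring

theorem artinSchreierHom_apply (y : F) : artinSchreierHom F y = y ^ 2 + y := rfl

theorem index_range_artinSchreierHom [Finite F] : (artinSchreierHom F).range.index = 2 := by
  have hker : ((artinSchreierHom F).ker : Set F) = {0, 1} := by
    ext y
    have := sq_add_self_eq_iff y 0
    simpa [artinSchreierHom_apply, AddMonoidHom.mem_ker] using this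
  have hcard : Nat.card (artinSchreierHom F).ker = 2 := by
    change Nat.card ((artinSchreierHom F).ker : Set F) = 2
    rw [hker, Nat.card_coe_set_eq, Set.ncard_pair zero_ne_one]
  have h1 := AddSubgroup.card_mul_index (artinSchreierHom F).ker
  have h2 := AddSubgroup.card_mul_index (artinSchreierHom F).range
  rw [hcard, AddSubgroup.index_ker] at h1
  have hpos : 0 < Nat.card (artinSchreierHom F).range := Nat.card_pos
  rw [← h1, mul_comm] at h2
  exact Nat.eq_of_mul_eq_mul_right hpos h2

theorem artinSchreierChar_add [Finite F] (a b : F) :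
    artinSchreierChar (a + b) = artinSchreierChar a * artinSchreierChar b := by
  classical
  have key (c : F) : artinSchreierChar c = if c ∈ (artinSchreierHom F).range then 1 else -1 :=
    rfl
  have h := AddSubgroup.add_mem_iff_of_index_two (index_range_artinSchreierHom (F := F))
    (a := a) (b := b)
  rw [key, key, key]
  by_cases ha : a ∈ (artinSchreierHom F).range <;>
    by_cases hb : b ∈ (artinSchreierHom F).range <;> simp [h, ha, hb]

variable [Fintype F] [DecidableEq F]

theorem card_sq_add_self_eq (c : F) :
    (Finset.card {y : F | y ^ 2 + y = c} : ℤ) = 1 + artinSchreierChar c := by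
  unfold artinSchreierChar
  split_ifs with h
  · obtain ⟨z, rfl⟩ := h
    have : ({y : F | y ^ 2 + y = z ^ 2 + z} : Finset F) = {z, z + 1} := by
      ext y
      simp [sq_add_self_eq_iff]
    rw [this, Finset.card_pair (by simp)]
    rfl
  · have : ({y : F | y ^ 2 + y = c} : Finset F) = ∅ := by
      ext y
      simpa using fun hy => h ⟨y, hy⟩
    simp [this]

theorem sum_artinSchreierChar : ∑ c : F, artinSchreierChar c = 0 := by
  have h := Finset.card_eq_sum_card_fiberwise (f := fun y : F => y ^ 2 + y)
    (s := Finset.univ) (t := Finset.univ) (fun _ _ => by simp)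
  have h' := congrArg (Nat.cast : ℕ → ℤ) h
  push_cast at h'
  simp only [card_sq_add_self_eq, Finset.sum_add_distrib] at h'
  simpa using h'

theorem sum_artinSchreierChar_mul (a : F) :
    ∑ x : F, artinSchreierChar (x * a) = if a = 0 then (Fintype.card F : ℤ) else 0 := by
  split_ifs with ha
  · simp [ha, artinSchreierChar_zero]
  · rw [← sum_artinSchreierChar (F := F)]
    exact Fintype.sum_equiv (Equiv.mulRight₀ a ha) _ _ fun _ => rfl

theorem sum_artinSchreierChar_polar (d : F) :
    ∑ x : F, artinSchreierChar (x ^ 2 * d + x * d ^ 2) =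
      if d + d ^ 4 = 0 then (Fintype.card F : ℤ) else 0 := by
  have h2 : (2 : F) = 0 := CharTwo.two_eq_zero
  rw [← sum_artinSchreierChar_mul]
  refine Fintype.sum_equiv (frobeniusEquiv F 2).toEquiv _ _ fun x => ?_
  have : x ^ 2 * d + x * d ^ 2 = x ^ 2 * (d + d ^ 4) + ((x * d ^ 2) ^ 2 + x * d ^ 2) := by
    linear_combination (-(x ^ 2 * d ^ 4)) * h2
  rw [this, artinSchreierChar_add, artinSchreierChar_sq_add_self, mul_one]
  rfl

theorem sq_sum_artinSchreierChar_cube {ω : F} (hω : ω ^ 2 + ω = 1) :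
    (∑ x : F, artinSchreierChar (x ^ 3)) ^ 2 = 4 * Fintype.card F := by
  have h2 : (2 : F) = 0 := CharTwo.two_eq_zero
  have h01 : ω ≠ 0 := by rintro rfl; simp at hω
  have h11 : ω ≠ 1 := by
    rintro rfl
    exact one_ne_zero (α := F) (by linear_combination hω)
  have hχ1 : artinSchreierChar (1 : F) = 1 := hω ▸ artinSchreierChar_sq_add_self ω
  have hset : ({d : F | d + d ^ 4 = 0} : Finset F) = {0, 1, ω, ω + 1} := by
    ext d
    have : d + d ^ 4 = d * ((d - 1) * ((d - ω) * (d - (ω + 1)))) := by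
      linear_combination (d - d ^ 2) * hω + (d + d ^ 3 * (1 + ω) - d ^ 2 * (1 + ω)) * h2
    simp only [Finset.mem_filter_univ, this, mul_eq_zero, sub_eq_zero, Finset.mem_insert,
      Finset.mem_singleton]
  have hexpand (x d : F) : artinSchreierChar (x ^ 3) * artinSchreierChar ((x + d) ^ 3) =
      artinSchreierChar (d ^ 3) * artinSchreierChar (x ^ 2 * d + x * d ^ 2) := by
    rw [← artinSchreierChar_add, ← artinSchreierChar_add]
    congr 1
    linear_combination (x ^ 3 + x ^ 2 * d + x * d ^ 2) * h2
  calc (∑ x : F, artinSchreierChar (x ^ 3)) ^ 2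
      = ∑ x : F, ∑ d : F, artinSchreierChar (x ^ 3) * artinSchreierChar ((x + d) ^ 3) := by
        rw [sq, Finset.sum_mul]
        refine Finset.sum_congr rfl fun x _ => ?_
        rw [← Finset.mul_sum]
        congr 1
        exact (Fintype.sum_equiv (Equiv.addLeft x) _ _ fun _ => rfl).symm
    _ = ∑ d : F, artinSchreierChar (d ^ 3) *
          if d + d ^ 4 = 0 then (Fintype.card F : ℤ) else 0 := by
        rw [Finset.sum_comm]
        simp only [hexpand, ← Finset.mul_sum, sum_artinSchreierChar_polar]
    _ = ∑ d ∈ {0, 1, ω, ω + 1}, artinSchreierChar (d ^ 3) * (Fintype.card F : ℤ) := by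
        rw [← hset, Finset.sum_filter]
        simp only [mul_ite, mul_zero]
    _ = 4 * Fintype.card F := by
        have hω3 : ω ^ 3 = 1 := by linear_combination (ω - 1) * hω + (ω - 1) * h2
        have hω3' : (ω + 1) ^ 3 = 1 := by
          linear_combination (ω + 2) * hω + (1 + ω) * h2
        have h1 : (0 : F) ∉ ({1, ω, ω + 1} : Finset F) := by
          simp only [Finset.mem_insert, Finset.mem_singleton, not_or]
          refine ⟨zero_ne_one, h01.symm, fun h => h11 ?_⟩
          linear_combination -h - h2
        have h3 : (1 : F) ∉ ({ω, ω + 1} : Finset F) := by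
          simp [h11.symm, h01]
        rw [Finset.sum_insert h1, Finset.sum_insert h3, Finset.sum_pair (by simp), hω3, hω3']
        simp only [one_pow, ne_eq, OfNat.ofNat_ne_zero, not_false_eq_true, zero_pow,
          artinSchreierChar_zero, hχ1]
        ring

theorem sum_artinSchreierChar_cube_modEq {ω : F} (hω : ω ^ 2 + ω = 1) :
    ∑ x : F, artinSchreierChar (x ^ 3) ≡ Fintype.card F [ZMOD 3] := by
  have h2 : (2 : F) = 0 := CharTwo.two_eq_zero
  have hω3 : ω ^ 3 = 1 := by linear_combination (ω - 1) * hω + (ω - 1) * h2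
  have h11 : ω ≠ 1 := by
    rintro rfl
    exact one_ne_zero (α := F) (by linear_combination hω)
  let f : Function.End {x : F // artinSchreierChar (x ^ 3) = -1} :=
    fun x => ⟨ω * x, by rw [mul_pow, hω3, one_mul]; exact x.2⟩
  have hf : f ^ 3 ^ 1 = 1 := by
    funext x
    refine Subtype.ext ?_
    change ω * (ω * (ω * (x : F))) = x
    linear_combination (x : F) * hω3
  have hfix : IsEmpty f.fixedPoints := by
    refine ⟨fun ⟨x, hx⟩ => ?_⟩
    have hx' : ω * (x : F) = x := congrArg Subtype.val hx
    have h0 : (x : F) = 0 := by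
      by_contra h
      exact h11 (mul_right_cancel₀ h (by rw [hx', one_mul]))
    have := x.2
    rw [h0] at this
    simp [artinSchreierChar_zero] at this
  have : Fact (Nat.Prime 3) := ⟨Nat.prime_three⟩
  have hmod := Equiv.Perm.card_fixedPoints_modEq hf
  rw [Fintype.card_eq_zero (α := f.fixedPoints), Fintype.card_subtype] at hmod
  obtain ⟨k, hk⟩ := (Nat.modEq_zero_iff_dvd).mp hmod
  have hsum : ∑ x : F, artinSchreierChar (x ^ 3) =
      Fintype.card F - 2 * Finset.card {x : F | artinSchreierChar (x ^ 3) = -1} := by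
    have (x : F) : artinSchreierChar (x ^ 3) =
        1 - 2 * if artinSchreierChar (x ^ 3) = -1 then 1 else 0 := by
      rcases artinSchreierChar_eq_one_or (x ^ 3) with h | h <;> simp [h]
    rw [Finset.sum_congr rfl fun x _ => this x, Finset.sum_sub_distrib, ← Finset.mul_sum]
    simp
  rw [hsum, hk]
  refine (Int.modEq_iff_dvd).mpr ⟨2 * k, ?_⟩
  push_cast
  ring

theorem exists_sq_add_self_eq_one {n : ℕ} (hF : Fintype.card F = 4 ^ n) :
    ∃ ω : F, ω ^ 2 + ω = 1 := by
  have h2 : (2 : F) = 0 := CharTwo.two_eq_zero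
  have : Fact (Nat.Prime 3) := ⟨Nat.prime_three⟩
  have hdvd : 3 ∣ Fintype.card Fˣ := by
    rw [Fintype.card_units, hF]
    simpa using Nat.sub_dvd_pow_sub_pow 4 1 n
  obtain ⟨u, hu⟩ := exists_prime_orderOf_dvd_card 3 hdvd
  have hu3 : (u : F) ^ 3 = 1 := by
    rw [← Units.val_pow_eq_pow_val, ← hu, pow_orderOf_eq_one, Units.val_one]
  have hu1 : (u : F) - 1 ≠ 0 := by
    rw [sub_ne_zero]
    intro h
    rw [Units.val_eq_one.mp h] at hu
    simp at hu
  refine ⟨u, mul_left_cancel₀ hu1 ?_⟩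
  linear_combination hu3 - ((u : F) - 1) * h2

theorem sum_artinSchreierChar_cube {n : ℕ} (hF : Fintype.card F = 4 ^ n) :
    ∑ x : F, artinSchreierChar (x ^ 3) = (-2) ^ (n + 1) := by
  obtain ⟨ω, hω⟩ := exists_sq_add_self_eq_one hF
  have hsq := sq_sum_artinSchreierChar_cube hω
  have hmod := sum_artinSchreierChar_cube_modEq hω
  rw [hF] at hsq hmod
  push_cast at hsq hmod
  have h4 : (4 : ℤ) ^ n ≡ 1 [ZMOD 3] := by
    simpa using (show (4 : ℤ) ≡ 1 [ZMOD 3] from rfl).pow n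
  have hT : (-2 : ℤ) ^ (n + 1) ≡ 1 [ZMOD 3] := by
    simpa using (show (-2 : ℤ) ≡ 1 [ZMOD 3] from rfl).pow (n + 1)
  have hTsq : ((-2 : ℤ) ^ (n + 1)) ^ 2 = 4 * 4 ^ n := by
    rw [← pow_mul, mul_comm, pow_mul, pow_succ]
    norm_num [mul_comm]
  rcases sq_eq_sq_iff_eq_or_eq_neg.mp (hsq.trans hTsq.symm) with h | h
  · exact h
  · have h1 := hmod.trans h4
    rw [h] at h1
    unfold Int.ModEq at h1 hT
    omega

theorem card_sq_add_self_eq_cubic {n : ℕ} (hF : Fintype.card F = 4 ^ n) :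
    (Fintype.card {p : F × F // p.2 ^ 2 + p.2 = p.1 ^ 3 + p.1 ^ 2 + p.1 + 1} : ℤ) =
      4 ^ n + (-2) ^ (n + 1) := by
  obtain ⟨ω, hω⟩ := exists_sq_add_self_eq_one hF
  have hχ (x : F) : artinSchreierChar (x ^ 3 + x ^ 2 + x + 1) = artinSchreierChar (x ^ 3) := by
    rw [← hω, add_assoc (x ^ 3), artinSchreierChar_add, artinSchreierChar_add,
      artinSchreierChar_sq_add_self, artinSchreierChar_sq_add_self, mul_one, mul_one]
  rw [Fintype.card_subtype, Finset.card_filter, Fintype.sum_prod_type]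
  simp only [← Finset.card_filter]
  push_cast
  simp only [card_sq_add_self_eq, Finset.sum_add_distrib, hχ, sum_artinSchreierChar_cube hF]
  simp [hF]

end ArtinSchreier

/-- The points of a Weierstrass curve are the nonsingular affine points and the point at
infinity. -/
def WeierstrassCurve.Affine.pointEquivOption {R : Type*} [CommRing R]
    (W : WeierstrassCurve.Affine R) :
    W.Point ≃ Option {p : R × R // W.Nonsingular p.1 p.2} where
  toFun
    | .zero => none
    | .some x y h => some ⟨(x, y), h⟩
  invFun
    | none => .zero
    | some p => .some p.1.1 p.1.2 p.2
  left_inv P := by cases P <;> rfl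
  right_inv P := by cases P <;> rfl

/-- Over the field `F` with `4^n` elements, the elliptic curve
`y² + y = x³ + x² + x + 1` has exactly `((-2)^n - 1)²` `F`-rational points
(including the point at infinity). -/
theorem stmt_4 (n : ℕ) (hn : 1 ≤ n)
    (W : WeierstrassCurve (GaloisField 2 (2 * n)))
    (hW : W = { a₁ := 0, a₂ := 1, a₃ := 1, a₄ := 1, a₆ := 1 }) :
    (Nat.card W.toAffine.Point : ℤ) = ((-2 : ℤ) ^ n - 1) ^ 2 := by
  classical
  have : Fintype (GaloisField 2 (2 * n)) := Fintype.ofFinite _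
  have h2 : (2 : GaloisField 2 (2 * n)) = 0 := CharTwo.two_eq_zero
  have hF : Fintype.card (GaloisField 2 (2 * n)) = 4 ^ n := by
    rw [← Nat.card_eq_fintype_card, GaloisField.card 2 (2 * n) (by omega), pow_mul]
    norm_num
  have hns (p : GaloisField 2 (2 * n) × GaloisField 2 (2 * n)) :
      W.toAffine.Nonsingular p.1 p.2 ↔ p.2 ^ 2 + p.2 = p.1 ^ 3 + p.1 ^ 2 + p.1 + 1 := by
    rw [WeierstrassCurve.Affine.nonsingular_iff', WeierstrassCurve.Affine.equation_iff]
    simp [hW, h2]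
  rw [Nat.card_congr (W.toAffine.pointEquivOption.trans
    (Equiv.optionCongr (Equiv.subtypeEquivRight hns))), Nat.card_eq_fintype_card,
    Fintype.card_option]
  push_cast
  rw [card_sq_add_self_eq_cubic hF]
  have h4 : (4 : ℤ) ^ n = ((-2) ^ n) ^ 2 := by
    rw [← pow_mul, mul_comm, pow_mul]
    norm_num
  rw [h4]
  ring
end

section
/- Let p be a prime with p ≡ 3 (mod 4) and let m ≥ 1. Let G be an additive abelian group isomorphic to (ℤ/p^m ℤ) × (ℤ/p^m ℤ), and let σ : G → G be a group automorphism satisfying σ(σ(x)) = −x for all x ∈ G. If P ∈ G has order p^m, then P and σ(P) generate G, i.e. the subgroup generated by {P, σ(P)} is all of G. -/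
theorem Int.prime_dvd_of_dvd_sq_add_sq {p : ℕ} (hp : p.Prime) (hp3 : p % 4 = 3) {a b : ℤ}
    (h : (p : ℤ) ∣ a ^ 2 + b ^ 2) : (p : ℤ) ∣ a ∧ (p : ℤ) ∣ b := by
  have := Fact.mk hp
  simp only [← ZMod.intCast_zmod_eq_zero_iff_dvd] at h ⊢
  push_cast at h
  constructor
  · by_contra ha
    exact ZMod.mod_four_ne_three_of_sq_eq_neg_sq' ha (eq_neg_of_add_eq_zero_right h) hp3
  · by_contra hb
    exact ZMod.mod_four_ne_three_of_sq_eq_neg_sq' hb (eq_neg_of_add_eq_zero_left h) hp3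

theorem sq_add_sq_zsmul_eq_zero {G : Type*} [AddCommGroup G] (σ : G ≃+ G)
    (hσ : ∀ x : G, σ (σ x) = -x) {P : G} {a b : ℤ} (h : a • P + b • σ P = 0) :
    (a ^ 2 + b ^ 2) • P = 0 := by
  have h' : a • σ P - b • P = 0 := by
    simpa [hσ, sub_eq_add_neg] using congrArg σ h
  calc (a ^ 2 + b ^ 2) • P = a • (a • P + b • σ P) - b • (a • σ P - b • P) := by module
    _ = 0 := by rw [h, h', smul_zero, smul_zero, sub_zero]

theorem pow_dvd_of_zsmul_add_zsmul_eq_zero {G : Type*} [AddCommGroup G] (σ : G ≃+ G)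
    (hσ : ∀ x : G, σ (σ x) = -x) {p : ℕ} (hp : p.Prime) (hp3 : p % 4 = 3) {m : ℕ}
    {P : G} (hP : addOrderOf P = p ^ m) {a b : ℤ} (h : a • P + b • σ P = 0) {k : ℕ}
    (hk : k ≤ m) : (p : ℤ) ^ k ∣ a ∧ (p : ℤ) ^ k ∣ b := by
  induction k with
  | zero => simp
  | succ k ih =>
    obtain ⟨⟨c, rfl⟩, ⟨d, rfl⟩⟩ := ih (by lia)
    obtain ⟨n, rfl⟩ := Nat.exists_eq_add_of_le hk
    have hQ : ((p : ℤ) ^ (k + n) * c) • P + ((p : ℤ) ^ (k + n) * d) • σ P = 0 := by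
      calc _ = (p : ℤ) ^ n • (((p : ℤ) ^ k * c) • P + ((p : ℤ) ^ k * d) • σ P) := by
            rw [pow_add]; module
        _ = 0 := by rw [h, smul_zero]
    have hR : c • ((p : ℤ) ^ (k + n) • P) + d • σ ((p : ℤ) ^ (k + n) • P) = 0 := by
      rw [map_zsmul, ← hQ]; module
    have hS := sq_add_sq_zsmul_eq_zero σ hσ hR
    rw [smul_smul, ← addOrderOf_dvd_iff_zsmul_eq_zero, hP, add_right_comm, pow_succ'] at hS
    push_cast at hS
    have hp0 : (p : ℤ) ^ (k + n) ≠ 0 := pow_ne_zero _ (by exact_mod_cast hp.ne_zero)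
    obtain ⟨hc, hd⟩ :=
      Int.prime_dvd_of_dvd_sq_add_sq hp hp3 ((mul_dvd_mul_iff_right hp0).mp hS)
    rw [pow_succ]
    exact ⟨mul_dvd_mul_left _ hc, mul_dvd_mul_left _ hd⟩


/-- Let `p ≡ 3 (mod 4)` be prime, `m ≥ 1`, and `G` an abelian group
isomorphic to `(ℤ/p^m) × (ℤ/p^m)`. If `σ` is an automorphism of `G` with `σ² = -1`
and `P ∈ G` has order `p^m`, then `P` and `σ P` generate `G`. -/
theorem stmt_10 (p : ℕ) (hp : p.Prime) (hp3 : p % 4 = 3) (m : ℕ) (hm : 1 ≤ m)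
    (G : Type*) [AddCommGroup G]
    (hG : Nonempty (G ≃+ (ZMod (p ^ m) × ZMod (p ^ m))))
    (σ : G ≃+ G) (hσ : ∀ x : G, σ (σ x) = -x)
    (P : G) (hP : addOrderOf P = p ^ m) :
    AddSubgroup.closure {P, σ P} = ⊤ := by
  obtain ⟨e⟩ := hG
  have : NeZero (p ^ m) := ⟨pow_ne_zero m hp.ne_zero⟩
  let f : ZMod (p ^ m) × ZMod (p ^ m) → G := fun x =>
    (x.1.val : ℤ) • P + (x.2.val : ℤ) • σ P
  have hf : Function.Injective f := by
    intro x y hxy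
    have h : ((x.1.val : ℤ) - y.1.val) • P + ((x.2.val : ℤ) - y.2.val) • σ P = 0 := by
      rw [← sub_eq_zero.mpr hxy]
      module
    obtain ⟨h₁, h₂⟩ := pow_dvd_of_zsmul_add_zsmul_eq_zero σ hσ hp hp3 hP h le_rfl
    rw [← Nat.cast_pow, ← ZMod.intCast_zmod_eq_zero_iff_dvd] at h₁ h₂
    ext
    · simpa [sub_eq_zero] using h₁
    · simpa [sub_eq_zero] using h₂
  have hef : Function.Surjective (e ∘ f) :=
    Finite.injective_iff_surjective.mp (e.injective.comp hf)
  refine eq_top_iff.mpr fun g _ => ?_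
  obtain ⟨x, hx⟩ := hef (e g)
  rw [← e.injective hx]
  exact AddSubgroup.add_mem _
    (AddSubgroup.zsmul_mem _ (AddSubgroup.subset_closure (by simp)) _)
    (AddSubgroup.zsmul_mem _ (AddSubgroup.subset_closure (by simp)) _)
end

section
/- Let p be an odd prime and let a, b be integers with a² + b² = p. Let π = a + bi ∈ ℤ[i] and let m ≥ 1. Then the additive group of the quotient ring ℤ[i]/(π^m) is cyclic of order p^m, i.e. it is isomorphic as an abelian group to ℤ/p^m ℤ. -/
open GaussianInt

theorem GaussianInt.quotient_span_singleton_equiv_zmod {z : GaussianInt} {n : ℕ}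
    (hcop : IsCoprime z.re z.im) (hn : z.re ^ 2 + z.im ^ 2 = n) :
    Nonempty ((GaussianInt ⧸ Ideal.span {z}) ≃+* ZMod n) := by
  obtain ⟨u, v, huv⟩ := hcop
  set r : ℤ := u * z.im - v * z.re with hr
  have hrr : (r : ZMod n) * r = ((-1 : ℤ) : ZMod n) := by
    rw [← Int.cast_mul, ZMod.intCast_eq_intCast_iff_dvd_sub, ← hn]
    exact ⟨-(u ^ 2 + v ^ 2), by linear_combination (u * z.re + v * z.im + 1) * huv⟩
  let f : GaussianInt →+* ZMod n := Zsqrtd.lift ⟨(r : ZMod n), hrr⟩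
  have hf (w : GaussianInt) : f w = ((w.re + w.im * r : ℤ) : ZMod n) := by
    simp [f, Zsqrtd.lift]
  have hker : RingHom.ker f = Ideal.span {z} := by
    ext w
    rw [RingHom.mem_ker, Ideal.mem_span_singleton, hf, ZMod.intCast_zmod_eq_zero_iff_dvd, ← hn]
    constructor
    · rintro ⟨c, hc⟩
      refine ⟨c * star z + w.im * ⟨v, u⟩, ?_⟩
      ext
      · simp
        linear_combination hc
      · simp
        linear_combination -w.im * huv
    · rintro ⟨c, rfl⟩
      refine ⟨u * (c.re + c.im * r) - z.im * c.im * (u ^ 2 + v ^ 2), ?_⟩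
      simp only [Zsqrtd.re_mul, Zsqrtd.im_mul, hr]
      linear_combination (-z.re * (c.re + c.im * (u * z.im - v * z.re)) +
        z.im * c.im * (u * z.re + v * z.im + 1)) * huv
  rw [← hker]
  exact ⟨RingHom.quotientKerEquivOfSurjective (ZMod.ringHom_surjective f)⟩

theorem GaussianInt.isCoprime_re_im_pow {p : ℕ} (hp : p.Prime) (hodd : Odd p)
    {z : GaussianInt} (hz : z.re ^ 2 + z.im ^ 2 = (p : ℤ)) (k : ℕ) :
    IsCoprime (z ^ k).re (z ^ k).im ∧ (z ^ k).re ^ 2 + (z ^ k).im ^ 2 = ((p ^ k : ℕ) : ℤ) := by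
  have hp' : Prime (p : ℤ) := Nat.prime_iff_prime_int.mp hp
  have hnorm : (z ^ k).re ^ 2 + (z ^ k).im ^ 2 = (p : ℤ) ^ k := by
    have h := map_pow Zsqrtd.normMonoidHom z k
    simp only [Zsqrtd.normMonoidHom, MonoidHom.coe_mk, OneHom.coe_mk, Zsqrtd.norm_def] at h
    rw [← hz]
    linear_combination h
  refine ⟨?_, by exact_mod_cast hnorm⟩
  have hre : ¬ (p : ℤ) ∣ z.re := fun h => by
    have him : (p : ℤ) ∣ z.im := by
      refine hp'.dvd_of_dvd_pow (n := 2) ?_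
      rw [← dvd_add_right (h.pow two_ne_zero), hz]
    have h2 : (p : ℤ) ^ 2 ∣ p :=
      (dvd_add (pow_dvd_pow_of_dvd h 2) (pow_dvd_pow_of_dvd him 2)).trans hz.dvd
    exact hp'.not_isUnit (isUnit_of_dvd_one ((mul_dvd_mul_iff_left hp'.ne_zero).mp
      (by simpa [sq] using h2)))
  have htwo : ¬ (p : ℤ) ∣ 2 := fun h => by
    have : p ∣ 2 := by exact_mod_cast h
    have := (Nat.prime_dvd_prime_iff_eq hp Nat.prime_two).mp this
    subst this
    exact absurd hodd (by decide)
  have hpow (j : ℕ) : ¬ (p : ℤ) ∣ (z ^ (j + 1)).re := by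
    induction j with
    | zero => simpa using hre
    | succ j ih =>
      have key : (z ^ (j + 1 + 1)).re = 2 * z.re * (z ^ (j + 1)).re - p * (z ^ j).re := by
        simp only [pow_succ, Zsqrtd.re_mul, Zsqrtd.im_mul, ← hz]
        ring
      rw [key, dvd_sub_left (dvd_mul_right _ _)]
      exact fun h => (hp'.dvd_or_dvd h).elim
        (fun h => (hp'.dvd_or_dvd h).elim htwo hre) ih
  cases k with
  | zero => simp [isCoprime_one_left]
  | succ j =>
    have hc : IsCoprime (z ^ (j + 1)).re ((p : ℤ) ^ (j + 1)) :=
      ((hp'.coprime_iff_not_dvd.mpr (hpow j)).symm).pow_right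
    rw [← hnorm, sq, IsCoprime.mul_add_left_right_iff, IsCoprime.pow_right_iff two_pos] at hc
    exact hc

/-- If `p` is an odd prime with `p = a² + b²` and `π = a + bi ∈ ℤ[i]`,
then for `m ≥ 1` the additive group of `ℤ[i]/(π^m)` is cyclic of order `p^m`. -/
theorem stmt_11 (p : ℕ) (hp : p.Prime) (hodd : Odd p) (a b : ℤ)
    (hab : a ^ 2 + b ^ 2 = (p : ℤ)) (m : ℕ) (hm : 1 ≤ m)
    (π : GaussianInt) (hπ : π = ⟨a, b⟩) :
    Nonempty ((GaussianInt ⧸ Ideal.span {π ^ m}) ≃+ ZMod (p ^ m)) := by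
  subst hπ
  obtain ⟨hcop, hnorm⟩ := GaussianInt.isCoprime_re_im_pow hp hodd (z := ⟨a, b⟩) hab m
  exact (GaussianInt.quotient_span_singleton_equiv_zmod hcop hnorm).map RingEquiv.toAddEquiv
end
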